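/- arXiv:2103.00060 — 2 statements merged into one kernel-verified Lean document; each statement's English description precedes it below -/
import Mathlib

section
/- Let b1* = T^(-1/6)·(w2/w1^5)^(1/12)·(w3/8)^(1/6) and b2* = T^(-1/6)·(w1/w2^5)^(1/12)·(w3/8)^(1/6). Then g(b1*, b2*) = w3/(T·b1*·b2*) + (w1·(b1*)^2 + w2·(b2*)^2)^2 = 3·(w1·w2·w3^2)^(1/3)·T^(-2/3); hence (b1*, b2*) jointly minimizes g over (0,∞)^2. -/
open Real

theorem three_mul_sq_le_two_mul_cube_div_add_sq {p q : ℝ} (hp : 0 < p) (hq : 0 < q) :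
    3 * q ^ 2 ≤ 2 * q ^ 3 / p + p ^ 2 := by
  have h : 2 * q ^ 3 / p + p ^ 2 - 3 * q ^ 2 = (p - q) ^ 2 * (p + 2 * q) / p := by
    field_simp
    ring
  have : 0 ≤ (p - q) ^ 2 * (p + 2 * q) / p := by positivity
  linarith

/-- If `w3 / T = 8 * w1 * w2 * q ^ 3`, then `12 * w1 * w2 * q ^ 2` is a lower bound of the joint
MSE objective. -/
theorem joint_mse_lower_bound {w1 w2 w3 T q b1 b2 : ℝ} (hw1 : 0 < w1) (hw2 : 0 < w2)
    (hq : 0 < q) (h : w3 / T = 8 * w1 * w2 * q ^ 3) (hb1 : 0 < b1) (hb2 : 0 < b2) :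
    12 * w1 * w2 * q ^ 2 ≤ w3 / (T * b1 * b2) + (w1 * b1 ^ 2 + w2 * b2 ^ 2) ^ 2 :=
  calc 12 * w1 * w2 * q ^ 2 = 4 * w1 * w2 * (3 * q ^ 2) := by ring
    _ ≤ 4 * w1 * w2 * (2 * q ^ 3 / (b1 * b2) + (b1 * b2) ^ 2) := by
      gcongr
      exact three_mul_sq_le_two_mul_cube_div_add_sq (mul_pos hb1 hb2) hq
    _ = w3 / (T * b1 * b2) + 4 * (w1 * b1 ^ 2) * (w2 * b2 ^ 2) := by
      rw [mul_assoc T, ← div_div w3 T, h]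
      ring
    _ ≤ w3 / (T * b1 * b2) + (w1 * b1 ^ 2 + w2 * b2 ^ 2) ^ 2 := by
      linarith [sq_nonneg (w1 * b1 ^ 2 - w2 * b2 ^ 2)]

theorem exists_pos_pow_eq {x : ℝ} (hx : 0 < x) {n : ℕ} (hn : n ≠ 0) : ∃ y, 0 < y ∧ y ^ n = x :=
  ⟨x ^ (n⁻¹ : ℝ), rpow_pos_of_pos hx _, rpow_inv_natCast_pow hx.le hn⟩

theorem rpow_eq_of_eq_pow {x y r : ℝ} {n : ℕ} (hy : 0 ≤ y) (hx : x = y ^ n) (hr : n * r = 1) :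
    x ^ r = y := by
  rw [hx, ← rpow_natCast, ← rpow_mul hy, hr, rpow_one]

/-- The optimal simultaneous bandwidths `b1* = T^(-1/6)·(w2/w1⁵)^(1/12)·(w3/8)^(1/6)` and
`b2* = T^(-1/6)·(w1/w2⁵)^(1/12)·(w3/8)^(1/6)` attain the value
`3·(w1·w2·w3²)^(1/3)·T^(-2/3)` of the joint MSE objective, and hence jointly minimize it
over `(0,∞)²`. -/
theorem optimal_bandwidths_minimize (w1 w2 w3 T : ℝ)
    (hw1 : 0 < w1) (hw2 : 0 < w2) (hw3 : 0 < w3) (hT : 0 < T)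
    (b1s b2s : ℝ)
    (hb1s : b1s = T ^ (-(1 : ℝ) / 6) * (w2 / w1 ^ 5) ^ ((1 : ℝ) / 12) * (w3 / 8) ^ ((1 : ℝ) / 6))
    (hb2s : b2s = T ^ (-(1 : ℝ) / 6) * (w1 / w2 ^ 5) ^ ((1 : ℝ) / 12) * (w3 / 8) ^ ((1 : ℝ) / 6)) :
    (w3 / (T * b1s * b2s) + (w1 * b1s ^ 2 + w2 * b2s ^ 2) ^ 2 =
      3 * (w1 * w2 * w3 ^ 2) ^ ((1 : ℝ) / 3) * T ^ (-(2 : ℝ) / 3)) ∧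
    ∀ b1 b2 : ℝ, 0 < b1 → 0 < b2 →
      w3 / (T * b1s * b2s) + (w1 * b1s ^ 2 + w2 * b2s ^ 2) ^ 2 ≤
        w3 / (T * b1 * b2) + (w1 * b1 ^ 2 + w2 * b2 ^ 2) ^ 2 := by
  obtain ⟨a, ha, rfl⟩ := exists_pos_pow_eq hw1 (n := 12) (by norm_num)
  obtain ⟨c, hc, rfl⟩ := exists_pos_pow_eq hw2 (n := 12) (by norm_num)
  obtain ⟨d, hd, hdw⟩ := exists_pos_pow_eq (div_pos hw3 (by norm_num : (0 : ℝ) < 8)) (n := 6)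
    (by norm_num)
  obtain rfl : w3 = 8 * d ^ 6 := by linarith
  obtain ⟨t, ht, rfl⟩ := exists_pos_pow_eq hT (n := 6) (by norm_num)
  have hT_bandwidth : (t ^ 6) ^ (-(1 : ℝ) / 6) = t⁻¹ := by
    rw [neg_div, rpow_neg hT.le, rpow_eq_of_eq_pow ht.le rfl (by norm_num)]
  have hT_value : (t ^ 6) ^ (-(2 : ℝ) / 3) = (t ^ 4)⁻¹ := by
    rw [neg_div, rpow_neg hT.le, ← rpow_natCast, ← rpow_mul ht.le, ← rpow_natCast]
    norm_num
  have hd_root : (8 * d ^ 6 / 8) ^ ((1 : ℝ) / 6) = d :=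
    rpow_eq_of_eq_pow (n := 6) hd.le (by ring) (by norm_num)
  have hca_root : (c ^ 12 / (a ^ 12) ^ 5) ^ ((1 : ℝ) / 12) = c / a ^ 5 :=
    rpow_eq_of_eq_pow (n := 12) (by positivity) (by ring) (by norm_num)
  have hac_root : (a ^ 12 / (c ^ 12) ^ 5) ^ ((1 : ℝ) / 12) = a / c ^ 5 :=
    rpow_eq_of_eq_pow (n := 12) (by positivity) (by ring) (by norm_num)
  have h_value_root : (a ^ 12 * c ^ 12 * (8 * d ^ 6) ^ 2) ^ ((1 : ℝ) / 3) =
      4 * a ^ 4 * c ^ 4 * d ^ 4 :=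
    rpow_eq_of_eq_pow (n := 3) (by positivity) (by ring) (by norm_num)
  rw [hT_bandwidth, hca_root, hd_root] at hb1s
  rw [hT_bandwidth, hac_root, hd_root] at hb2s
  rw [hT_value, h_value_root]
  have h_value : 8 * d ^ 6 / (t ^ 6 * b1s * b2s) + (a ^ 12 * b1s ^ 2 + c ^ 12 * b2s ^ 2) ^ 2 =
      3 * (4 * a ^ 4 * c ^ 4 * d ^ 4) * (t ^ 4)⁻¹ := by
    rw [hb1s, hb2s]
    field_simp
    ring
  refine ⟨h_value, fun b1 b2 hb1 hb2 => h_value.trans_le ?_⟩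
  have h_balance : 8 * d ^ 6 / t ^ 6 =
      8 * a ^ 12 * c ^ 12 * (d ^ 2 / (t ^ 2 * a ^ 4 * c ^ 4)) ^ 3 := by
    field_simp
  refine le_of_eq_of_le ?_ (joint_mse_lower_bound hw1 hw2 (by positivity) h_balance hb1 hb2)
  field_simp
  norm_num
end

section
/- The spectral window generator of the quadratic spectral kernel is the rescaled parabolic density: for every ω with |ω| ≤ 6π/5, (2π)^{-1}·∫_ℝ K_QS(x)·cos(ω·x) dx = (5/(8π))·(1 − (5ω/(6π))^2), and for every ω with |ω| > 6π/5 the integral (2π)^{-1}·∫_ℝ K_QS(x)·cos(ω·x) dx equals 0. -/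
open Real MeasureTheory

/-- The quadratic spectral (QS) kernel. -/
noncomputable def KQS (x : ℝ) : ℝ :=
  if x = 0 then 1
  else (25 / (12 * Real.pi ^ 2 * x ^ 2)) *
    (Real.sin (6 * Real.pi * x / 5) / (6 * Real.pi * x / 5) - Real.cos (6 * Real.pi * x / 5))

open FourierTransform

/-- The parabolic density on `[-3/5, 3/5]`, whose Fourier transform is the QS kernel. -/
noncomputable def parabolicDensity (v : ℝ) : ℝ := max 0 (5 / 4 * (1 - 25 / 9 * v ^ 2))

lemma continuous_parabolicDensity : Continuous parabolicDensity := by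
  unfold parabolicDensity
  fun_prop

lemma parabolicDensity_of_abs_le {v : ℝ} (hv : |v| ≤ 3 / 5) :
    parabolicDensity v = 5 / 4 * (1 - 25 / 9 * v ^ 2) := by
  obtain ⟨h₁, h₂⟩ := abs_le.mp hv
  exact max_eq_right (by nlinarith)

lemma parabolicDensity_of_le_abs {v : ℝ} (hv : 3 / 5 ≤ |v|) : parabolicDensity v = 0 := by
  refine max_eq_left ?_
  rw [← sq_abs]
  nlinarith

lemma integrable_parabolicDensity : Integrable fun v ↦ (parabolicDensity v : ℂ) := by
  refine Continuous.integrable_of_hasCompactSupport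
    (Complex.continuous_ofReal.comp continuous_parabolicDensity) ?_
  refine HasCompactSupport.intro (isCompact_Icc (a := (-3 / 5 : ℝ)) (b := 3 / 5)) fun v hv ↦ ?_
  rw [parabolicDensity_of_le_abs, Complex.ofReal_zero]
  by_contra! h
  obtain ⟨h₁, h₂⟩ := abs_lt.mp h
  exact hv ⟨by linarith, h₂.le⟩

lemma hasDerivAt_exp_mul_quadratic {c : ℂ} (hc : c ≠ 0) (v : ℝ) :
    HasDerivAt (fun v : ℝ ↦ Complex.exp (c * v) *
      (5 / 4 * (1 - 25 / 9 * (v : ℂ) ^ 2) / c + 125 / 18 * v / c ^ 2 - 125 / 18 / c ^ 3))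
      (Complex.exp (c * v) * (5 / 4 * (1 - 25 / 9 * (v : ℂ) ^ 2))) v := by
  have hz : HasDerivAt (fun z : ℂ ↦ Complex.exp (c * z) *
      (5 / 4 * (1 - 25 / 9 * z ^ 2) / c + 125 / 18 * z / c ^ 2 - 125 / 18 / c ^ 3))
      (Complex.exp (c * v) * (5 / 4 * (1 - 25 / 9 * (v : ℂ) ^ 2))) v := by
    have he := ((hasDerivAt_id (v : ℂ)).const_mul c).cexp
    have hp := (((((((hasDerivAt_id (v : ℂ)).pow 2).const_mul (25 / 9)).const_sub 1).const_mul
      (5 / 4)).div_const c).add (((hasDerivAt_id (v : ℂ)).const_mul (125 / 18)).div_const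
      (c ^ 2))).sub_const (125 / 18 / c ^ 3)
    refine (he.mul hp).congr_deriv ?_
    simp only [id, Pi.add_apply, Pi.pow_apply]
    field_simp
    ring
  exact hz.comp_ofReal

lemma fourier_parabolicDensity_eq_intervalIntegral (x : ℝ) :
    𝓕 (fun v ↦ (parabolicDensity v : ℂ)) x =
      ∫ v in (-3 / 5 : ℝ)..3 / 5, Complex.exp (-2 * π * x * Complex.I * v) *
        (5 / 4 * (1 - 25 / 9 * (v : ℂ) ^ 2)) := by
  rw [Real.fourier_real_eq_integral_exp_smul, intervalIntegral.integral_of_le (by norm_num),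
    ← integral_Icc_eq_integral_Ioc, ← setIntegral_eq_integral_of_forall_compl_eq_zero
      (s := Set.Icc (-3 / 5 : ℝ) (3 / 5))]
  · refine setIntegral_congr_fun measurableSet_Icc fun v hv ↦ ?_
    have hv' : |v| ≤ 3 / 5 := abs_le.mpr ⟨by linarith [hv.1], hv.2⟩
    simp only [parabolicDensity_of_abs_le hv', smul_eq_mul]
    push_cast
    ring_nf
  · intro v hv
    rw [parabolicDensity_of_le_abs, Complex.ofReal_zero, smul_zero]
    by_contra! h
    obtain ⟨h₁, h₂⟩ := abs_lt.mp h
    exact hv ⟨by linarith, h₂.le⟩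

lemma fourier_parabolicDensity (x : ℝ) :
    𝓕 (fun v ↦ (parabolicDensity v : ℂ)) x = KQS x := by
  rw [fourier_parabolicDensity_eq_intervalIntegral]
  rcases eq_or_ne x 0 with rfl | hx
  · have h : ∀ v : ℝ, Complex.exp (-2 * π * (0 : ℝ) * Complex.I * v) *
        (5 / 4 * (1 - 25 / 9 * (v : ℂ) ^ 2)) = ((5 / 4 * (1 - 25 / 9 * v ^ 2) : ℝ) : ℂ) := by
      intro v
      simp
    simp only [h, intervalIntegral.integral_ofReal, KQS, if_true]
    norm_num [integral_pow]
  · have hπ : (π : ℂ) ≠ 0 := by exact_mod_cast Real.pi_ne_zero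
    have hx' : (x : ℂ) ≠ 0 := by exact_mod_cast hx
    have hc : -2 * π * x * Complex.I ≠ 0 := by simp [hx, Real.pi_ne_zero]
    rw [intervalIntegral.integral_eq_sub_of_hasDerivAt
      (fun v _ ↦ hasDerivAt_exp_mul_quadratic hc v)
      (Continuous.intervalIntegrable (by fun_prop) _ _)]
    have e₁ : -2 * π * x * Complex.I * ((3 / 5 : ℝ) : ℂ) =
        -(6 * π * x / 5 : ℂ) * Complex.I := by push_cast; ring
    have e₂ : -2 * π * x * Complex.I * ((-3 / 5 : ℝ) : ℂ) =
        (6 * π * x / 5 : ℂ) * Complex.I := by push_cast; ring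
    rw [e₁, e₂, Complex.exp_mul_I, Complex.exp_mul_I, Complex.cos_neg, Complex.sin_neg, KQS,
      if_neg hx]
    have hI₂ : Complex.I ^ 2 = -1 := Complex.I_sq
    have hI₃ : Complex.I ^ 3 = -Complex.I := Complex.I_pow_three
    push_cast
    generalize Complex.cos (6 * π * x / 5) = C
    generalize Complex.sin (6 * π * x / 5) = S
    simp only [mul_pow, hI₂, hI₃]
    field_simp
    ring_nf

lemma abs_KQS_mul_sq_le (x : ℝ) : |KQS x| * x ^ 2 ≤ 5 := by
  rcases eq_or_ne x 0 with rfl | hx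
  · simp
  · have hs : |Real.sin (6 * π * x / 5) / (6 * π * x / 5)| ≤ 1 := by
      rw [abs_div]
      exact div_le_one_of_le₀ Real.abs_sin_le_abs (abs_nonneg _)
    have hsub : |Real.sin (6 * π * x / 5) / (6 * π * x / 5) - Real.cos (6 * π * x / 5)| ≤ 2 :=
      (abs_sub _ _).trans (by linarith [Real.abs_cos_le_one (6 * π * x / 5)])
    have hx2 : 0 < x ^ 2 := by positivity
    rw [KQS, if_neg hx, abs_mul, abs_of_nonneg (by positivity)]
    have hp : 25 / (12 * π ^ 2 * x ^ 2) * x ^ 2 ≤ 5 / 2 := by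
      have : 25 / (12 * π ^ 2 * x ^ 2) * x ^ 2 = 25 / (12 * π ^ 2) := by field_simp
      rw [this, div_le_div_iff₀ (by positivity) (by norm_num)]
      nlinarith [Real.pi_gt_three]
    calc _ = (25 / (12 * π ^ 2 * x ^ 2) * x ^ 2) *
          |Real.sin (6 * π * x / 5) / (6 * π * x / 5) - Real.cos (6 * π * x / 5)| := by ring
      _ ≤ 5 / 2 * 2 := by gcongr
      _ = 5 := by norm_num

lemma integrable_KQS : Integrable fun x ↦ (KQS x : ℂ) := by
  have hcont : Continuous (𝓕 fun v ↦ (parabolicDensity v : ℂ)) :=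
    VectorFourier.fourierIntegral_continuous Real.continuous_fourierChar continuous_inner
      integrable_parabolicDensity
  have hK : (𝓕 fun v ↦ (parabolicDensity v : ℂ)) = fun x ↦ (KQS x : ℂ) :=
    funext fourier_parabolicDensity
  rw [hK] at hcont
  set M := ∫ v, ‖(parabolicDensity v : ℂ)‖
  have hM (x : ℝ) : |KQS x| ≤ M := by
    have h := VectorFourier.norm_fourierIntegral_le_integral_norm Real.fourierChar volume
      (innerₗ ℝ) (fun v ↦ (parabolicDensity v : ℂ)) x
    change ‖𝓕 (fun v ↦ (parabolicDensity v : ℂ)) x‖ ≤ M at h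
    rwa [fourier_parabolicDensity, Complex.norm_real] at h
  refine (integrable_inv_one_add_sq.const_mul (M + 5)).mono' hcont.aestronglyMeasurable
    (Filter.Eventually.of_forall fun x ↦ ?_)
  rw [Complex.norm_real, ← div_eq_mul_inv, le_div_iff₀ (by positivity), Real.norm_eq_abs]
  linarith [hM x, abs_KQS_mul_sq_le x]

lemma integral_KQS_mul_cos (ω : ℝ) :
    ∫ x, KQS x * Real.cos (ω * x) = parabolicDensity (ω / (2 * π)) := by
  have hK : (𝓕 fun v ↦ (parabolicDensity v : ℂ)) = fun x ↦ (KQS x : ℂ) :=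
    funext fourier_parabolicDensity
  have hinv := integrable_parabolicDensity.fourierInv_fourier_eq (hK ▸ integrable_KQS)
    (Complex.continuous_ofReal.comp continuous_parabolicDensity).continuousAt
    (v := ω / (2 * π))
  rw [hK, Real.fourierInv_eq'] at hinv
  have hre (x : ℝ) : (Complex.exp (((2 * π * inner ℝ x (ω / (2 * π)) : ℝ) : ℂ) * Complex.I) •
      (KQS x : ℂ)).re = KQS x * Real.cos (ω * x) := by
    have harg : 2 * π * inner ℝ x (ω / (2 * π)) = ω * x := by
      simp only [RCLike.inner_apply, conj_trivial]
      field_simp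
    rw [harg, smul_eq_mul, Complex.re_mul_ofReal, Complex.exp_ofReal_mul_I_re, mul_comm]
  have hint : Integrable fun x : ℝ ↦
      Complex.exp (((2 * π * inner ℝ x (ω / (2 * π)) : ℝ) : ℂ) * Complex.I) • (KQS x : ℂ) := by
    refine integrable_KQS.bdd_mul (c := 1) (Continuous.aestronglyMeasurable (by fun_prop)) ?_
    exact Filter.Eventually.of_forall fun x ↦ (Complex.norm_exp_ofReal_mul_I _).le
  have h := congrArg Complex.re hinv
  rw [← RCLike.re_eq_complex_re, ← integral_re hint] at h
  simpa only [RCLike.re_eq_complex_re, hre, Complex.ofReal_re] using h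

/-- The spectral window generator of the QS kernel is the rescaled parabolic density:
`(2π)⁻¹ ∫ K_QS(x) cos(ωx) dx = (5/(8π))(1 - (5ω/(6π))²)` for `|ω| ≤ 6π/5` and `0` for
`|ω| > 6π/5`. -/
theorem KQS_spectral_window_generator :
    (∀ ω : ℝ, |ω| ≤ 6 * Real.pi / 5 →
      (2 * Real.pi)⁻¹ * ∫ x, KQS x * Real.cos (ω * x) =
        (5 / (8 * Real.pi)) * (1 - (5 * ω / (6 * Real.pi)) ^ 2)) ∧
    (∀ ω : ℝ, 6 * Real.pi / 5 < |ω| →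
      (2 * Real.pi)⁻¹ * ∫ x, KQS x * Real.cos (ω * x) = 0) := by
  have hπ := Real.pi_pos
  have habs (ω : ℝ) : |ω / (2 * π)| = |ω| / (2 * π) := by
    rw [abs_div, abs_of_pos (by positivity : 0 < 2 * π)]
  refine ⟨fun ω hω ↦ ?_, fun ω hω ↦ ?_⟩
  · rw [integral_KQS_mul_cos, parabolicDensity_of_abs_le]
    · field_simp
      ring
    · rw [habs, div_le_iff₀ (by positivity)]
      linarith
  · rw [integral_KQS_mul_cos, parabolicDensity_of_le_abs, mul_zero]
    rw [habs, le_div_iff₀ (by positivity)]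
    linarith
end
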